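/- arXiv:2212.13862 — 2 statements merged into one kernel-verified Lean document; each statement's English description precedes it below -/
import Mathlib

section
/- Fix d ≥ 1 and a set A ⊆ (0, ∞) satisfying ACC. Then there exists a real number c > 0 with the following property: for every compact polytope □ = conv(F) ⊆ ℝ^d, where F is a finite set, such that □ has nonempty interior, 0 ∈ □, every nonzero extremal point of □ is of the form (1/a) • e with e ∈ ℤ^d primitive and a ∈ A, and ℤ^d ∩ interior □ ≠ ∅, the Pikhurko constant satisfies γ(ℤ^d, □) ≥ c. -/
open Pointwise

/-- The coefficient of asymmetry `γ(P ∈ K) = sSup {t ≥ 0 : P + t • (K - K) ⊆ K}`. -/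
noncomputable def asym {E : Type*} [AddCommGroup E] [Module ℝ E] (K : Set E) (P : E) : ℝ :=
  sSup {t : ℝ | 0 ≤ t ∧ ∀ x ∈ K - K, P + t • x ∈ K}

/-- The integer lattice `ℤ^d` inside `ℝ^d`. -/
def intLat (d : ℕ) : Set (Fin d → ℝ) := {x | ∀ i, ∃ z : ℤ, x i = (z : ℝ)}

/-- The Pikhurko constant `γ(ℤ^d, K)`: the supremum of the coefficients of asymmetry over
lattice points of the interior of `K`. -/
noncomputable def pik {d : ℕ} (K : Set (Fin d → ℝ)) : ℝ :=
  sSup (asym K '' (intLat d ∩ interior K))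

/-- A vector of `ℤ^d` is primitive if it is nonzero and the gcd of its coordinates is `1`. -/
def Primitive {d : ℕ} (e : Fin d → ℤ) : Prop :=
  e ≠ 0 ∧ Finset.univ.gcd (fun i => (e i).natAbs) = 1

/-- A set of reals satisfies the ascending chain condition if it admits no strictly
increasing sequence. -/
def ACCSet (A : Set ℝ) : Prop := ¬ ∃ f : ℕ → ℝ, StrictMono f ∧ ∀ n, f n ∈ A

lemma two_cos_pow_eq_sum (R : ℕ) (θ : ℝ) :
    (((2 * Real.cos (Real.pi * θ)) ^ (2 * R) : ℝ) : ℂ) =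
      ∑ k ∈ Finset.range (2 * R + 1), ((2 * R).choose k : ℂ) *
        Complex.exp (2 * Real.pi * Complex.I * (((k : ℤ) - (R : ℤ) : ℤ) * θ)) := by
  have h : ((2 * Real.cos (Real.pi * θ) : ℝ) : ℂ) =
      Complex.exp (Real.pi * θ * Complex.I) + Complex.exp (-(Real.pi * θ * Complex.I)) := by
    push_cast
    rw [Complex.two_cos]
    ring_nf
  rw [Complex.ofReal_pow, h, add_pow]
  refine Finset.sum_congr rfl fun k hk => ?_
  have hk' : k ≤ 2 * R := by simpa [Nat.lt_succ_iff] using hk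
  rw [← Complex.exp_nat_mul, ← Complex.exp_nat_mul, ← Complex.exp_add, mul_comm, Nat.cast_sub hk']
  congr 2
  push_cast
  ring

lemma exists_lower_bound_re_mul_sum_exp (C α β : ℝ) (hC : 0 ≤ C)
    (h : (∃ z : ℤ, α = z) → ∃ z : ℤ, β = z) :
    ∃ B : ℝ, ∀ n : ℕ, -B ≤ (∑ m ∈ Finset.range n,
      (C : ℂ) * Complex.exp (2 * Real.pi * Complex.I * (m * α - β))).re := by
  by_cases hα : ∃ z : ℤ, α = z
  · obtain ⟨w, hw⟩ := h hα
    obtain ⟨z, hz⟩ := hα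
    refine ⟨0, fun n => ?_⟩
    rw [Complex.re_sum, neg_zero]
    refine Finset.sum_nonneg fun m _ => ?_
    have : (2 * Real.pi * Complex.I * (m * α - β) : ℂ) =
        ((m * z - w : ℤ) : ℂ) * (2 * Real.pi * Complex.I) := by
      subst hz hw; push_cast; ring
    rw [this, Complex.exp_int_mul_two_pi_mul_I]
    simpa using hC
  · set q : ℂ := Complex.exp (2 * Real.pi * Complex.I * α) with hq
    have hq1 : q ≠ 1 := by
      intro h1
      rw [hq, Complex.exp_eq_one_iff] at h1
      obtain ⟨z, hz⟩ := h1
      refine hα ⟨z, ?_⟩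
      have h2 : (2 * Real.pi * Complex.I : ℂ) ≠ 0 := Complex.two_pi_I_ne_zero
      have : (α : ℂ) = (z : ℂ) := by
        apply mul_left_cancel₀ h2
        rw [hz]; ring
      exact_mod_cast this
    have hqn : ‖q‖ = 1 := by
      rw [hq, show (2 * Real.pi * Complex.I * α : ℂ) = ((2 * Real.pi * α : ℝ) : ℂ) * Complex.I by
        push_cast; ring]
      exact Complex.norm_exp_ofReal_mul_I _
    refine ⟨C * (2 / ‖q - 1‖), fun n => ?_⟩
    have hsum : (∑ m ∈ Finset.range n,
        (C : ℂ) * Complex.exp (2 * Real.pi * Complex.I * (m * α - β))) =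
        C * Complex.exp (((-(2 * Real.pi * β) : ℝ) : ℂ) * Complex.I) * ((q ^ n - 1) / (q - 1)) := by
      rw [← geom_sum_eq hq1, Finset.mul_sum]
      refine Finset.sum_congr rfl fun m _ => ?_
      rw [hq, ← Complex.exp_nat_mul, mul_assoc (C : ℂ), ← Complex.exp_add]
      congr 2
      push_cast
      ring
    have hn : ‖∑ m ∈ Finset.range n,
        (C : ℂ) * Complex.exp (2 * Real.pi * Complex.I * (m * α - β))‖ ≤ C * (2 / ‖q - 1‖) := by
      rw [hsum, norm_mul, norm_mul, Complex.norm_exp_ofReal_mul_I, mul_one, norm_div,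
        Complex.norm_real, Real.norm_of_nonneg hC]
      gcongr
      calc ‖q ^ n - 1‖ ≤ ‖q ^ n‖ + ‖(1 : ℂ)‖ := norm_sub_le _ _
        _ = 2 := by rw [norm_pow, hqn]; norm_num
    have := (abs_le.1 ((Complex.abs_re_le_norm _).trans hn)).1
    exact this

lemma cos_sq_le_of_le_abs_sub {ε θ : ℝ} (hε : 0 ≤ ε) (h : ∀ z : ℤ, ε ≤ |θ - z|) :
    Real.cos (Real.pi * θ) ^ 2 ≤ Real.cos (Real.pi * ε) ^ 2 := by
  have h1 := h (round θ)
  have h2 : |θ - round θ| ≤ 1 / 2 := abs_sub_round θ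
  set t := |θ - round θ| with ht
  have hpi := Real.pi_pos
  have e : Real.cos (Real.pi * θ) ^ 2 = Real.cos (Real.pi * t) ^ 2 := by
    have hθ : Real.pi * θ = Real.pi * (θ - round θ) + (round θ : ℤ) * Real.pi := by ring
    rw [hθ, Real.cos_add_int_mul_pi, mul_pow, ← Real.cos_abs (Real.pi * (θ - round θ)), abs_mul,
      abs_of_pos hpi, ← sq_abs ((-1 : ℝ) ^ round θ)]
    simp [ht]
  rw [e]
  have hcos : 0 ≤ Real.cos (Real.pi * t) :=
    Real.cos_nonneg_of_mem_Icc ⟨by nlinarith [abs_nonneg (θ - round θ)], by nlinarith⟩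
  have : Real.cos (Real.pi * t) ≤ Real.cos (Real.pi * ε) :=
    Real.cos_le_cos_of_nonneg_of_le_pi (by positivity) (by nlinarith) (by nlinarith)
  gcongr

lemma exists_pow_lt_centralBinom_pow (N : ℕ) {q : ℝ} (hq0 : 0 ≤ q) (hq : q < 1) :
    ∃ R : ℕ, (4 : ℝ) ^ (R * N) * q ^ R < (R.centralBinom : ℝ) ^ N := by
  have h := tendsto_pow_const_mul_const_pow_of_abs_lt_one N (r := q) (by rwa [abs_of_nonneg hq0])
  obtain ⟨R, hR, hR4⟩ := ((h.eventually (gt_mem_nhds one_pos)).and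
    (Filter.eventually_ge_atTop 4)).exists
  refine ⟨R, ?_⟩
  have h4 : ((4 : ℝ) ^ R) ≤ R * R.centralBinom := by
    exact_mod_cast (Nat.four_pow_lt_mul_centralBinom R hR4).le
  have hc : (0 : ℝ) < (R.centralBinom : ℝ) ^ N := by
    have := Nat.centralBinom_pos R
    positivity
  calc (4 : ℝ) ^ (R * N) * q ^ R ≤ (R * R.centralBinom) ^ N * q ^ R := by
        rw [pow_mul]; gcongr
    _ = (R.centralBinom : ℝ) ^ N * (R ^ N * q ^ R) := by rw [mul_pow]; ring
    _ < (R.centralBinom : ℝ) ^ N * 1 := by gcongr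
    _ = _ := mul_one _

/-- A quantitative form of Kronecker's approximation theorem. -/
lemma exists_int_mul_approx (N : ℕ) {ε : ℝ} (hε : 0 < ε) :
    ∃ R : ℕ, ∀ x y : Fin N → ℝ,
      (∀ χ : Fin N → ℤ, (∀ i, |χ i| ≤ R) → (∃ z : ℤ, ∑ i, χ i * x i = z) →
        ∃ z : ℤ, ∑ i, χ i * y i = z) →
      ∃ (m : ℤ) (n : Fin N → ℤ), ∀ i, |m * x i - n i - y i| < ε := by
  wlog hε2 : ε ≤ 1 / 2 generalizing ε
  · obtain ⟨R, hR⟩ := this (ε := 1 / 2) (by norm_num) le_rfl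
    refine ⟨R, fun x y h => ?_⟩
    obtain ⟨m, n, hmn⟩ := hR x y h
    exact ⟨m, n, fun i => (hmn i).trans (not_le.1 hε2)⟩
  set q := Real.cos (Real.pi * ε) ^ 2 with hqdef
  have hpi := Real.pi_pos
  have hq0 : 0 ≤ q := sq_nonneg _
  have hq1 : q < 1 := by
    have h1 : Real.cos (Real.pi * ε) < 1 := by
      rw [← Real.cos_zero]
      exact Real.cos_lt_cos_of_nonneg_of_le_pi le_rfl (by nlinarith) (by positivity)
    have h2 : 0 ≤ Real.cos (Real.pi * ε) :=
      Real.cos_nonneg_of_mem_Icc ⟨by nlinarith, by nlinarith⟩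
    rw [hqdef]; nlinarith
  obtain ⟨R, hR⟩ := exists_pow_lt_centralBinom_pow N hq0 hq1
  refine ⟨R, fun x y h => ?_⟩
  by_contra! hcon
  set g : ℕ → ℝ := fun m => ∏ i, (2 * Real.cos (Real.pi * (m * x i - y i))) ^ (2 * R) with hg
  have hone : ∀ θ : ℝ, (2 * Real.cos (Real.pi * θ)) ^ (2 * R) ≤ 4 ^ R := fun θ => by
    rw [pow_mul]
    have := Real.cos_sq_le_one (Real.pi * θ)
    gcongr
    nlinarith
  have hg_le : ∀ m, g m ≤ 4 ^ (R * N) * q ^ R := by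
    intro m
    have hex : ∃ i, ∀ z : ℤ, ε ≤ |(m * x i - y i) - z| := by
      by_contra! hno
      choose n hn using hno
      obtain ⟨i, hi⟩ := hcon m n
      have := hn i
      rw [sub_right_comm] at this
      push_cast at hi
      linarith
    obtain ⟨i, hi⟩ := hex
    have hci := cos_sq_le_of_le_abs_sub hε.le hi
    have hN : N = (Finset.univ.erase i).card + 1 := by
      rw [Finset.card_erase_add_one (Finset.mem_univ i), Finset.card_univ, Fintype.card_fin]
    rw [hg]
    simp only
    rw [← Finset.mul_prod_erase _ _ (Finset.mem_univ i)]
    calc _ ≤ (4 * q) ^ R * ∏ j ∈ Finset.univ.erase i, (4 : ℝ) ^ R := by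
          gcongr with j hj
          · exact Finset.prod_nonneg fun j _ => by rw [pow_mul]; positivity
          · rw [pow_mul]
            gcongr
            nlinarith
          · intro j _
            rw [pow_mul]
            positivity
          · exact hone _
      _ = 4 ^ (R * N) * q ^ R := by
          rw [Finset.prod_const, mul_pow]
          conv_rhs => rw [hN]
          ring
  set P := Fintype.piFinset fun _ : Fin N => Finset.range (2 * R + 1) with hP
  set C : (Fin N → ℕ) → ℝ := fun p => ∏ i, ((2 * R).choose (p i) : ℝ) with hC
  set χ : (Fin N → ℕ) → Fin N → ℤ := fun p i => (p i : ℤ) - R with hχ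
  have hgexp : ∀ m : ℕ, (g m : ℂ) = ∑ p ∈ P, (C p : ℂ) *
      Complex.exp (2 * Real.pi * Complex.I *
        (m * (∑ i, χ p i * x i : ℝ) - (∑ i, χ p i * y i : ℝ))) := by
    intro m
    rw [hg]
    simp only
    rw [Complex.ofReal_prod]
    simp_rw [two_cos_pow_eq_sum]
    rw [Finset.prod_univ_sum]
    refine Finset.sum_congr rfl fun p _ => ?_
    rw [Finset.prod_mul_distrib, ← Complex.exp_sum, hC]
    push_cast
    congr 2
    rw [← Finset.mul_sum, Finset.mul_sum (s := Finset.univ) (a := (m : ℂ)),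
      ← Finset.sum_sub_distrib]
    congr 1
    refine Finset.sum_congr rfl fun i _ => ?_
    simp only [hχ]
    push_cast
    ring
  have hB : ∀ p ∈ P, ∃ B : ℝ, ∀ n : ℕ, -B ≤ (∑ m ∈ Finset.range n, (C p : ℂ) *
      Complex.exp (2 * Real.pi * Complex.I *
        (m * (∑ i, χ p i * x i : ℝ) - (∑ i, χ p i * y i : ℝ)))).re := by
    intro p hp
    refine exists_lower_bound_re_mul_sum_exp _ _ _ (Finset.prod_nonneg fun i _ => by positivity)
      (h (χ p) fun i => ?_)
    have := Finset.mem_range.1 (Fintype.mem_piFinset.1 hp i)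
    rw [abs_le]
    constructor <;> simp only [hχ] <;> omega
  choose! B hB using hB
  set p₀ : Fin N → ℕ := fun _ => R with hp₀
  have hp₀P : p₀ ∈ P := Fintype.mem_piFinset.2 fun i => by
    rw [Finset.mem_range]; simp only [hp₀]; omega
  have hC₀ : C p₀ = (R.centralBinom : ℝ) ^ N := by
    simp [hC, hp₀, Nat.centralBinom]
  have hkey : ∀ n : ℕ, n * (R.centralBinom : ℝ) ^ N - ∑ p ∈ P.erase p₀, B p ≤
      n * (4 ^ (R * N) * q ^ R) := by
    intro n
    have h1 : ∑ m ∈ Finset.range n, g m ≤ n * (4 ^ (R * N) * q ^ R) := by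
      have := Finset.sum_le_card_nsmul (Finset.range n) g _ fun m _ => hg_le m
      simpa using this
    have h2 : ∑ m ∈ Finset.range n, g m = ∑ p ∈ P, (∑ m ∈ Finset.range n, (C p : ℂ) *
      Complex.exp (2 * Real.pi * Complex.I *
        (m * (∑ i, χ p i * x i : ℝ) - (∑ i, χ p i * y i : ℝ)))).re := by
      rw [← Complex.re_sum, Finset.sum_comm, ← Complex.ofReal_re (∑ m ∈ Finset.range n, g m)]
      congr 1
      push_cast
      refine Finset.sum_congr rfl fun m _ => ?_
      rw [hgexp m]
      push_cast
      rfl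
    have h3 : (∑ m ∈ Finset.range n, (C p₀ : ℂ) *
      Complex.exp (2 * Real.pi * Complex.I *
        (m * (∑ i, χ p₀ i * x i : ℝ) - (∑ i, χ p₀ i * y i : ℝ)))).re =
        n * (R.centralBinom : ℝ) ^ N := by
      rw [hC₀]
      simp only [hχ, hp₀, sub_self, Int.cast_zero, zero_mul, Finset.sum_const_zero,
        Complex.ofReal_zero, mul_zero, Complex.exp_zero, mul_one, Finset.sum_const,
        Finset.card_range, nsmul_eq_mul]
      rw [← Complex.ofReal_natCast, ← Complex.ofReal_mul, Complex.ofReal_re]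
    have h4 : -∑ p ∈ P.erase p₀, B p ≤ ∑ p ∈ P.erase p₀, (∑ m ∈ Finset.range n, (C p : ℂ) *
      Complex.exp (2 * Real.pi * Complex.I *
        (m * (∑ i, χ p i * x i : ℝ) - (∑ i, χ p i * y i : ℝ)))).re := by
      rw [← Finset.sum_neg_distrib]
      exact Finset.sum_le_sum fun p hp => hB p (Finset.mem_of_mem_erase hp) n
    rw [h2, ← Finset.add_sum_erase _ _ hp₀P, h3] at h1
    linarith
  obtain ⟨n, hn⟩ := exists_nat_gt
    ((∑ p ∈ P.erase p₀, B p) / ((R.centralBinom : ℝ) ^ N - 4 ^ (R * N) * q ^ R))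
  rw [div_lt_iff₀ (by linarith)] at hn
  have := hkey n
  nlinarith

/-- The integral linear forms taking an integral value at `x`. -/
def integralForms {N : ℕ} (x : Fin N → ℝ) : Submodule ℤ (Fin N → ℤ) where
  carrier := {χ | ∃ z : ℤ, ∑ i, χ i * x i = z}
  zero_mem' := ⟨0, by simp⟩
  add_mem' := by
    rintro χ ψ ⟨z, hz⟩ ⟨w, hw⟩
    refine ⟨z + w, ?_⟩
    simp only [Pi.add_apply, Int.cast_add, add_mul, Finset.sum_add_distrib, hz, hw]
  smul_mem' := by
    rintro k χ ⟨z, hz⟩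
    refine ⟨k * z, ?_⟩
    simp only [Pi.smul_apply, smul_eq_mul, Int.cast_mul, mul_assoc, ← Finset.mul_sum, hz]

lemma mem_integralForms {N : ℕ} {x : Fin N → ℝ} {χ : Fin N → ℤ} :
    χ ∈ integralForms x ↔ ∃ z : ℤ, ∑ i, χ i * x i = z := Iff.rfl

/-- A uniform version of Lawrence's finiteness theorem: the cyclic subgroups of the torus meeting
an open set all meet a single compact subset of it. -/
lemma exists_isCompact_forall_exists_int_mul_sub_mem {N : ℕ} {U : Set (Fin N → ℝ)}
    (hU : IsOpen U) :
    ∃ C : Set (Fin N → ℝ), IsCompact C ∧ C ⊆ U ∧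
      ∀ x ∈ U, ∃ (m : ℤ) (n : Fin N → ℤ), (fun i => m * x i - n i) ∈ C := by
  suffices h : ∀ M : Submodule ℤ (Fin N → ℤ), ∃ C : Set (Fin N → ℝ), IsCompact C ∧ C ⊆ U ∧
      ∀ x ∈ U, M ≤ integralForms x →
        ∃ (m : ℤ) (n : Fin N → ℤ), (fun i => m * x i - n i) ∈ C by
    obtain ⟨C, hC, hCU, hx⟩ := h ⊥
    exact ⟨C, hC, hCU, fun x hxU => hx x hxU bot_le⟩
  intro M
  induction M using WellFoundedGT.induction with
  | ind M ih =>
  by_cases hy : ∃ y ∈ U, M ≤ integralForms y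
  swap
  · exact ⟨∅, isCompact_empty, Set.empty_subset _, fun x hx hM => (hy ⟨x, hx, hM⟩).elim⟩
  obtain ⟨y, hyU, hyM⟩ := hy
  obtain ⟨ε, hε, hball⟩ := Metric.nhds_basis_closedBall.mem_iff.1 (hU.mem_nhds hyU)
  obtain ⟨R, hR⟩ := exists_int_mul_approx N hε
  choose! C hC hCU hCx using ih
  set S : Set (Fin N → ℤ) := {χ | (∀ i, |χ i| ≤ R) ∧ χ ∉ M} with hS
  have hSfin : S.Finite := by
    refine (Set.finite_Icc (fun _ : Fin N => -(R : ℤ)) (fun _ => (R : ℤ))).subset ?_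
    rintro χ ⟨hχ, -⟩
    exact ⟨fun i => (abs_le.1 (hχ i)).1, fun i => (abs_le.1 (hχ i)).2⟩
  have hlt : ∀ χ ∈ S, M < M ⊔ Submodule.span ℤ {χ} := by
    rintro χ ⟨-, hχ⟩
    refine lt_of_le_of_ne le_sup_left fun h => hχ ?_
    rw [h]
    exact Submodule.mem_sup_right (Submodule.mem_span_singleton_self χ)
  refine ⟨Metric.closedBall y ε ∪ ⋃ χ ∈ S, C (M ⊔ Submodule.span ℤ {χ}),
    (isCompact_closedBall y ε).union (hSfin.isCompact_biUnion fun χ hχ => hC _ (hlt χ hχ)),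
    Set.union_subset hball (Set.iUnion₂_subset fun χ hχ => hCU _ (hlt χ hχ)), ?_⟩
  intro x hx hM
  by_cases hχ : ∃ χ ∈ S, χ ∈ integralForms x
  · obtain ⟨χ, hχS, hχx⟩ := hχ
    obtain ⟨m, n, hmn⟩ := hCx _ (hlt χ hχS) x hx
      (sup_le hM ((Submodule.span_singleton_le_iff_mem _ _).2 hχx))
    exact ⟨m, n, Or.inr (Set.mem_biUnion hχS hmn)⟩
  · push Not at hχ
    obtain ⟨m, n, hmn⟩ := hR x y fun χ hχR hχx => by
      by_contra hχy
      exact hχ χ ⟨hχR, fun hχM => hχy (hyM hχM)⟩ hχx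
    refine ⟨m, n, Or.inl ?_⟩
    rw [mem_closedBall_iff_norm, pi_norm_le_iff_of_nonneg hε.le]
    exact fun i => (hmn i).le

lemma ACCSet.exists_antitone_subseq {A : Set ℝ} (hA : ACCSet A) {N : ℕ} (f : ℕ → Fin N → ℝ)
    (hf : ∀ n i, f n i ∈ A) : ∃ φ : ℕ → ℕ, StrictMono φ ∧ Antitone (f ∘ φ) := by
  have hwf : WellFoundedGT A := by
    refine ⟨RelEmbedding.wellFounded_iff_isEmpty.2 ⟨fun g => hA ⟨fun n => g n, ?_, fun n => (g n).2⟩⟩⟩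
    exact fun a b hab => g.map_rel_iff.2 hab
  obtain ⟨φ, hφ⟩ := (Set.isPWO_of_wellQuasiOrderedLE
    (Set.univ : Set (Fin N → (A)ᵒᵈ))).exists_monotone_subseq
      (f := fun n i => OrderDual.toDual ⟨f n i, hf n i⟩) fun _ => Set.mem_univ _
  exact ⟨φ, φ.strictMono, fun a b hab i => hφ hab i⟩

/-- The positive open simplex `{y > 0, ∑ aᵢ yᵢ < 1}` for limiting weights `a ≥ 0`. -/
lemma exists_uniform_bounds {N : ℕ} (a : Fin N → ℝ) :
    ∃ c : ℝ, 0 < c ∧ ∀ x : Fin N → ℝ, (∀ i, 0 < x i) → ∑ i, a i * x i < 1 →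
      ∃ (m : ℤ) (n : Fin N → ℤ), (∀ i, c ≤ m * x i - n i) ∧ (∀ i, m * x i - n i ≤ c⁻¹) ∧
        ∑ i, a i * (m * x i - n i) ≤ 1 - c := by
  set U : Set (Fin N → ℝ) := {y | (∀ i, 0 < y i) ∧ ∑ i, a i * y i < 1} with hUdef
  have hU : IsOpen U := by
    rw [hUdef, Set.ofPred_and, Set.ofPred_forall]
    refine (isOpen_iInter_of_finite fun i => isOpen_lt continuous_const (continuous_apply i)).inter
      (isOpen_lt (by fun_prop) continuous_const)
  obtain ⟨C, hC, hCU, hx⟩ := exists_isCompact_forall_exists_int_mul_sub_mem hU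
  have h1 : ∀ i, ∃ c : ℝ, 0 < c ∧ ∀ y ∈ C, c ≤ y i := fun i =>
    hC.exists_forall_le' (continuous_apply i).continuousOn fun y hy => (hCU hy).1 i
  obtain ⟨c₂, hc₂, h2⟩ : ∃ c : ℝ, 0 < c ∧ ∀ y ∈ C, c ≤ 1 - ∑ i, a i * y i :=
    hC.exists_forall_le' (Continuous.continuousOn (by fun_prop)) fun y hy => by
      linarith [(hCU hy).2]
  obtain ⟨B, hB⟩ := hC.isBounded.exists_norm_le
  choose c₁ hc₁ h1 using h1
  have hev : ∀ᶠ c : ℝ in nhdsWithin 0 (Set.Ioi 0),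
      (∀ i, c ≤ c₁ i) ∧ c ≤ c₂ ∧ c * B ≤ 1 ∧ 0 < c := by
    refine (Filter.eventually_all.2 fun i => ?_).and
      (Filter.Eventually.and ?_ (Filter.Eventually.and ?_ self_mem_nhdsWithin))
    · exact nhdsWithin_le_nhds (Iic_mem_nhds (hc₁ i))
    · exact nhdsWithin_le_nhds (Iic_mem_nhds hc₂)
    · refine nhdsWithin_le_nhds ?_
      have : Filter.Tendsto (fun c : ℝ => c * B) (nhds 0) (nhds (0 * B)) :=
        (continuous_mul_const B).tendsto 0
      rw [zero_mul] at this
      exact this.eventually (Iic_mem_nhds one_pos)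
  obtain ⟨c, hcc₁, hcc₂, hcB, hc⟩ := hev.exists
  refine ⟨c, hc, fun x hx0 hx1 => ?_⟩
  obtain ⟨m, n, hmn⟩ := hx x ⟨hx0, hx1⟩
  refine ⟨m, n, fun i => (hcc₁ i).trans (h1 i _ hmn), fun i => ?_, ?_⟩
  · have h3 := (le_abs_self _).trans ((norm_le_pi_norm _ i).trans (hB _ hmn))
    refine h3.trans ?_
    rw [← one_div, le_div_iff₀ hc]
    linarith
  · have := h2 _ hmn
    linarith

/-- Uniformity over all weights from an ACC set. -/
lemma exists_uniform_weighted_bound {A : Set ℝ} (hA : A ⊆ Set.Ioi 0) (hACC : ACCSet A) (N : ℕ) :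
    ∃ c : ℝ, 0 < c ∧ ∀ a x : Fin N → ℝ, (∀ i, a i ∈ A) → (∀ i, 0 < x i) →
      ∑ i, a i * x i < 1 →
      ∃ (m : ℤ) (n : Fin N → ℤ), (∀ i, c ≤ a i * (m * x i - n i)) ∧
        ∑ i, a i * (m * x i - n i) ≤ 1 := by
  by_contra! hcon
  choose a x ha hx hax hbad using fun t : ℕ => hcon (1 / ((t : ℝ) + 1)) Nat.one_div_pos_of_nat
  obtain ⟨φ, hφ, hanti⟩ := hACC.exists_antitone_subseq a ha
  have hpos : ∀ t i, 0 < a t i := fun t i => hA (ha t i)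
  have hbdd : ∀ i, BddBelow (Set.range fun t => a (φ t) i) := fun i =>
    ⟨0, by rintro _ ⟨t, rfl⟩; exact (hpos _ i).le⟩
  set b : Fin N → ℝ := fun i => ⨅ t, a (φ t) i with hb
  have hlim : ∀ i, Filter.Tendsto (fun t => a (φ t) i) Filter.atTop (nhds (b i)) := fun i =>
    tendsto_atTop_ciInf (fun s t hst => hanti hst i) (hbdd i)
  have hble : ∀ t i, b i ≤ a (φ t) i := fun t i => ciInf_le (hbdd i) t
  have hb0 : ∀ i, 0 ≤ b i := fun i => le_ciInf fun t => (hpos _ i).le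
  obtain ⟨c, hc, hcx⟩ := exists_uniform_bounds b
  set ρ : ℝ := c / (2 * (N + 1)) with hρ
  have hρ0 : 0 < ρ := by positivity
  have hNρ : N * ρ ≤ c / 2 := by
    rw [hρ, mul_div_assoc', div_le_div_iff₀ (by positivity) (by positivity)]
    nlinarith
  -- for large times the weights are close to their limits
  have hsum : Filter.Tendsto (fun t => ∑ i, (a (φ t) i - b i) * c⁻¹) Filter.atTop (nhds 0) := by
    have : Filter.Tendsto (fun t => ∑ i, (a (φ t) i - b i) * c⁻¹) Filter.atTop
        (nhds (∑ i, (b i - b i) * c⁻¹)) :=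
      tendsto_finsetSum _ fun i _ => ((hlim i).sub_const _).mul_const _
    simpa using this
  have hev1 : ∀ᶠ t in Filter.atTop, ∑ i, (a (φ t) i - b i) * c⁻¹ < c / 2 :=
    hsum.eventually (gt_mem_nhds (by positivity))
  have hev2 : ∀ᶠ t in Filter.atTop, ∀ i, b i = 0 → a (φ t) i < ρ / 2 :=
    Filter.eventually_all.2 fun i => by
      by_cases h : b i = 0
      · have := (hlim i).eventually (gt_mem_nhds (show b i < ρ / 2 by rw [h]; positivity))
        filter_upwards [this] with t ht _ using ht
      · exact Filter.Eventually.of_forall fun t h' => (h h').elim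
  have hinv : Filter.Tendsto (fun t : ℕ => 1 / ((φ t : ℝ) + 1)) Filter.atTop (nhds 0) :=
    tendsto_one_div_add_atTop_nhds_zero_nat.comp hφ.tendsto_atTop
  have hev3 : ∀ᶠ t in Filter.atTop, 1 / ((φ t : ℝ) + 1) < ρ / 2 :=
    hinv.eventually (gt_mem_nhds (by positivity))
  have hev4 : ∀ᶠ t in Filter.atTop, ∀ i, b i ≠ 0 → 1 / ((φ t : ℝ) + 1) < b i * c :=
    Filter.eventually_all.2 fun i => by
      by_cases h : b i = 0
      · exact Filter.Eventually.of_forall fun t h' => (h' h).elim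
      · have := hinv.eventually (gt_mem_nhds (mul_pos ((hb0 i).lt_of_ne' h) hc))
        filter_upwards [this] with t ht _ using ht
  obtain ⟨t, ht1, ht2, ht3, ht4⟩ := (hev1.and (hev2.and (hev3.and hev4))).exists
  obtain ⟨m, n, h1, h2, h3⟩ := hcx (x (φ t)) (hx _)
    ((Finset.sum_le_sum fun i _ =>
      mul_le_mul_of_nonneg_right (hble t i) (hx _ i).le).trans_lt (hax _))
  set y : Fin N → ℝ := fun i => m * x (φ t) i - n i with hy
  -- coordinates with vanishing limit weight may be shifted by large integers
  set s : Fin N → ℤ := fun i => if b i = 0 then ⌊ρ / a (φ t) i⌋ else 0 with hs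
  have hs0 : ∀ i, a (φ t) i * s i ≤ ρ := by
    intro i
    have hp := hpos (φ t) i
    simp only [hs]
    split_ifs with h
    · calc a (φ t) i * (⌊ρ / a (φ t) i⌋ : ℝ) ≤ a (φ t) i * (ρ / a (φ t) i) := by
            gcongr; exact Int.floor_le _
        _ = ρ := by field_simp
    · simpa using hρ0.le
  have hs1 : ∀ i, b i = 0 → ρ / 2 ≤ a (φ t) i * s i := by
    intro i h
    have hp := hpos (φ t) i
    simp only [hs, if_pos h]
    have h4 : a (φ t) i * (ρ / a (φ t) i - 1) ≤ a (φ t) i * (⌊ρ / a (φ t) i⌋ : ℝ) := by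
      gcongr; exact (Int.sub_one_lt_floor _).le
    have h5 : a (φ t) i * (ρ / a (φ t) i - 1) = ρ - a (φ t) i := by field_simp
    linarith [ht2 i h]
  have hexp : ∀ i, a (φ t) i * (m * x (φ t) i - ((n i - s i : ℤ) : ℝ)) =
      a (φ t) i * y i + a (φ t) i * s i := by
    intro i
    simp only [hy]
    push_cast
    ring
  refine absurd (hbad (φ t) m (fun i => n i - s i) fun i => ?_) (not_lt.2 ?_)
  · rw [hexp]
    have hyc : c ≤ y i := h1 i
    by_cases h : b i = 0
    · have := hs1 i h
      have : 0 ≤ a (φ t) i * y i := mul_nonneg (hpos _ i).le (hc.le.trans hyc)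
      linarith
    · have : b i * c ≤ a (φ t) i * y i :=
        mul_le_mul (hble t i) hyc hc.le (hpos _ i).le
      have h6 : a (φ t) i * s i = 0 := by simp [hs, h]
      linarith [ht4 i h]
  · simp_rw [hexp]
    rw [Finset.sum_add_distrib]
    have h7 : ∑ i, a (φ t) i * s i ≤ N * ρ := by
      have := Finset.sum_le_card_nsmul Finset.univ (fun i => a (φ t) i * s i) ρ fun i _ => hs0 i
      simpa using this
    have h8 : ∑ i, a (φ t) i * y i ≤ ∑ i, b i * y i + ∑ i, (a (φ t) i - b i) * c⁻¹ := by
      rw [← Finset.sum_add_distrib]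
      refine Finset.sum_le_sum fun i _ => ?_
      have := mul_le_mul_of_nonneg_left (h2 i) (sub_nonneg.2 (hble t i))
      simp only [hy]
      linarith
    have h9 : ∑ i, b i * y i ≤ 1 - c := h3
    linarith

lemma exists_uniform_weighted_bound_of_card_le {A : Set ℝ} (hA : A ⊆ Set.Ioi 0) (hACC : ACCSet A)
    (N : ℕ) :
    ∃ c : ℝ, 0 < c ∧ ∀ (ι : Type) [Fintype ι], Fintype.card ι ≤ N →
      ∀ a x : ι → ℝ, (∀ i, a i ∈ A) → (∀ i, 0 < x i) → ∑ i, a i * x i < 1 →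
      ∃ (m : ℤ) (n : ι → ℤ), (∀ i, c ≤ a i * (m * x i - n i)) ∧
        ∑ i, a i * (m * x i - n i) ≤ 1 := by
  choose c hc h using exists_uniform_weighted_bound hA hACC
  obtain ⟨k, hk, hmin⟩ := (Finset.range (N + 1)).exists_min_image c ⟨0, by simp⟩
  refine ⟨c k, hc k, fun ι _ hcard a x ha hx hax => ?_⟩
  set e := Fintype.equivFin ι
  obtain ⟨m, n, h1, h2⟩ := h (Fintype.card ι) (a ∘ e.symm) (x ∘ e.symm) (fun i => ha _)
    (fun i => hx _) (by
      rw [← e.sum_comp]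
      simpa using hax)
  refine ⟨m, n ∘ e, fun i => ?_, ?_⟩
  · have := h1 (e i)
    simp only [Function.comp_apply, e.symm_apply_apply] at this
    exact (hmin _ (by simpa [Nat.lt_succ_iff] using hcard)).trans this
  · rw [← e.sum_comp] at h2
    simpa using h2

lemma span_cons_one_eq_top {d : ℕ} {V : Set (Fin d → ℝ)}
    (hint : (interior (convexHull ℝ V)).Nonempty) :
    Submodule.span ℝ ((fun v : Fin d → ℝ => (Fin.cons 1 v : Fin (d + 1) → ℝ)) '' V) = ⊤ := by
  set L : (Fin d → ℝ) → Fin (d + 1) → ℝ := fun v => Fin.cons 1 v with hL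
  set W := Submodule.span ℝ (L '' V) with hW
  have hLW : ∀ x ∈ convexHull ℝ V, L x ∈ W := by
    refine convexHull_min (t := {x | L x ∈ W})
      (fun v hv => Submodule.subset_span ⟨v, hv, rfl⟩) ?_
    intro x hx y hy α β _ _ hαβ
    have : L (α • x + β • y) = α • L x + β • L y := by
      ext i
      refine Fin.cases ?_ (fun j => ?_) i <;> simp [hL, hαβ]
    change L (α • x + β • y) ∈ W
    rw [this]
    exact W.add_mem (W.smul_mem _ hx) (W.smul_mem _ hy)
  obtain ⟨p, hp⟩ := hint
  refine eq_top_iff.2 fun z _ => ?_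
  set w : Fin d → ℝ := Fin.tail z - z 0 • p with hw
  have hcont : Filter.Tendsto (fun ε : ℝ => p + ε • w) (nhds 0) (nhds (p + (0 : ℝ) • w)) :=
    Continuous.tendsto (by fun_prop) 0
  rw [zero_smul, add_zero] at hcont
  obtain ⟨ε, hεK, hε⟩ := (((hcont.eventually (mem_interior_iff_mem_nhds.1 hp)).filter_mono
    (nhdsWithin_le_nhds (s := Set.Ioi (0 : ℝ)))).and self_mem_nhdsWithin).exists
  have hε' : ε ≠ 0 := ne_of_gt hε
  have hz : z = z 0 • L p + ε⁻¹ • (L (p + ε • w) - L p) := by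
    ext i
    refine Fin.cases ?_ (fun j => ?_) i
    · simp [hL]
    · simp [hL, hw, Fin.tail, hε']
  rw [hz]
  exact W.add_mem (W.smul_mem _ (hLW _ (interior_subset hp)))
    (W.smul_mem _ (W.sub_mem (hLW _ hεK) (hLW _ (interior_subset hp))))

/-- A simplex of maximal volume with vertices in `V`: all points of the convex hull of `V` have
barycentric coordinates in `[-1, 1]`. -/
lemma exists_simplex_abs_barycentric_le_one {d : ℕ} {V : Set (Fin d → ℝ)} (hV : V.Finite)
    (hint : (interior (convexHull ℝ V)).Nonempty) :
    ∃ v : Fin (d + 1) → Fin d → ℝ, (∀ i, v i ∈ V) ∧ ∀ x ∈ convexHull ℝ V,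
      ∃ l : Fin (d + 1) → ℝ, (∀ i, |l i| ≤ 1) ∧ ∑ i, l i = 1 ∧ ∑ i, l i • v i = x := by
  set L : (Fin d → ℝ) → Fin (d + 1) → ℝ := fun v => Fin.cons 1 v with hL
  have hspan := span_cons_one_eq_top hint
  set D : (Fin (d + 1) → Fin d → ℝ) → Matrix (Fin (d + 1)) (Fin (d + 1)) ℝ :=
    fun v => Matrix.of fun i j => L (v j) i with hD
  obtain ⟨u, huV, hu⟩ : ∃ u : Fin (d + 1) → Fin d → ℝ, (∀ i, u i ∈ V) ∧ (D u).det ≠ 0 := by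
    obtain ⟨f, hfV, -, hf⟩ := Submodule.exists_fun_fin_finrank_span_eq ℝ (L '' V)
    have hrank : Module.finrank ℝ (Submodule.span ℝ (L '' V)) = d + 1 := by
      rw [hspan, finrank_top]; simp
    choose u huV hu using hfV
    refine ⟨u ∘ Fin.cast hrank.symm, fun i => huV _, ?_⟩
    have hli : LinearIndependent ℝ (f ∘ Fin.cast hrank.symm) :=
      hf.comp _ (Fin.cast_injective _)
    have hcol : (D (u ∘ Fin.cast hrank.symm)).col = f ∘ Fin.cast hrank.symm := by
      ext i j
      simp [hD, Matrix.col, hu]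
    rw [← hcol, Matrix.linearIndependent_cols_iff_isUnit] at hli
    exact ((Matrix.isUnit_iff_isUnit_det _).1 hli).ne_zero
  set T : Set (Fin (d + 1) → Fin d → ℝ) := Set.univ.pi fun _ => V with hT
  obtain ⟨v, hvT, hmax⟩ := Set.exists_max_image T (fun v => |(D v).det|)
    (Set.Finite.pi fun _ => hV) ⟨u, fun i _ => huV i⟩
  have hv : (D v).det ≠ 0 := fun h => hu (by
    have := hmax u fun i _ => huV i
    rw [h, abs_zero] at this
    exact abs_nonpos_iff.1 this)
  refine ⟨v, fun i => hvT i trivial, ?_⟩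
  refine convexHull_min (t := {x | ∃ l : Fin (d + 1) → ℝ, (∀ i, |l i| ≤ 1) ∧ ∑ i, l i = 1 ∧
    ∑ i, l i • v i = x}) (fun w hw => ?_) ?_
  · set l : Fin (d + 1) → ℝ := fun i => ((D v).cramer (L w) i) / (D v).det with hl
    have hlin : (D v).mulVec l = L w := by
      have h1 : l = (D v).det⁻¹ • (D v).cramer (L w) := by
        ext i; simp [hl, div_eq_inv_mul]
      rw [h1, Matrix.mulVec_smul, Matrix.mulVec_cramer, smul_smul, inv_mul_cancel₀ hv, one_smul]
    refine ⟨l, fun i => ?_, ?_, ?_⟩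
    · rw [hl]
      simp only
      rw [abs_div, div_le_one (abs_pos.2 hv), Matrix.cramer_apply]
      have : (D v).updateCol i (L w) = D (Function.update v i w) := by
        ext j k
        by_cases hk : k = i
        · subst hk; simp [hD]
        · simp [hD, hk]
      rw [this]
      refine hmax _ fun j _ => ?_
      by_cases hj : j = i
      · subst hj; simpa using hw
      · simpa [hj] using hvT j trivial
    · have := congrFun hlin 0
      simpa [Matrix.mulVec, dotProduct, hD, hL] using this
    · ext k
      have := congrFun hlin k.succ
      simpa [Matrix.mulVec, dotProduct, hD, hL, Finset.sum_apply, mul_comm] using this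
  · rintro x ⟨l, hl, hl1, rfl⟩ y ⟨l', hl', hl1', rfl⟩ α β hα hβ hαβ
    refine ⟨fun i => α * l i + β * l' i, fun i => ?_, ?_, ?_⟩
    · calc |α * l i + β * l' i| ≤ |α * l i| + |β * l' i| := abs_add_le _ _
        _ = α * |l i| + β * |l' i| := by rw [abs_mul, abs_mul, abs_of_nonneg hα, abs_of_nonneg hβ]
        _ ≤ α * 1 + β * 1 := by gcongr <;> simp [hl, hl']
        _ = 1 := by linarith
    · rw [Finset.sum_add_distrib, ← Finset.mul_sum, ← Finset.mul_sum, hl1, hl1']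
      linarith
    · simp [add_smul, Finset.sum_add_distrib, Finset.smul_sum, smul_smul]

lemma Convex.sum_smul_mem_of_sum_le_one {E ι : Type*} [AddCommGroup E] [Module ℝ E] [Fintype ι]
    {K : Set E} (hK : Convex ℝ K) (h0 : (0 : E) ∈ K) {w : ι → ℝ} {z : ι → E}
    (hw : ∀ i, 0 ≤ w i) (hw1 : ∑ i, w i ≤ 1) (hz : ∀ i, z i ∈ K) : ∑ i, w i • z i ∈ K := by
  have := hK.sum_mem (t := Finset.univ) (w := fun o : Option ι => o.elim (1 - ∑ i, w i) w)
    (z := fun o : Option ι => o.elim 0 z)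
    (by rintro (_ | i) _ <;> simp [hw, hw1])
    (by simp [Fintype.sum_option])
    (by rintro (_ | i) _ <;> simp [h0, hz])
  simpa [Fintype.sum_option] using this

lemma nontrivial_of_nonempty_interior {d : ℕ} (hd : 1 ≤ d) {K : Set (Fin d → ℝ)}
    (hint : (interior K).Nonempty) : K.Nontrivial := by
  have : Nonempty (Fin d) := ⟨⟨0, hd⟩⟩
  obtain ⟨p, hp⟩ := hint
  have : (nhdsWithin p {p}ᶜ).NeBot := Module.punctured_nhds_neBot ℝ _ p
  exact (infinite_of_mem_nhds p (mem_interior_iff_mem_nhds.1 hp)).nontrivial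

lemma le_pik {d : ℕ} (hd : 1 ≤ d) {K : Set (Fin d → ℝ)} (hK : Bornology.IsBounded K)
    (hint : (interior K).Nonempty) {P : Fin d → ℝ} (hP : P ∈ intLat d) {t : ℝ} (ht : 0 < t)
    (hPt : ∀ x ∈ K - K, P + t • x ∈ K) : t ≤ pik K := by
  obtain ⟨x, hx, y, hy, hxy⟩ := nontrivial_of_nonempty_interior hd hint
  have hn : 0 < ‖x - y‖ := norm_pos_iff.2 (sub_ne_zero.2 hxy)
  have hub : ∀ Q ∈ K, ∀ s ∈ {s : ℝ | 0 ≤ s ∧ ∀ x ∈ K - K, Q + s • x ∈ K},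
      s ≤ Metric.diam K / ‖x - y‖ := by
    rintro Q hQ s ⟨hs0, hs⟩
    have h1 := Metric.dist_le_diam_of_mem hK (hs _ (Set.sub_mem_sub hx hy)) hQ
    rw [dist_eq_norm, add_sub_cancel_left, norm_smul, Real.norm_of_nonneg hs0] at h1
    rwa [le_div_iff₀ hn]
  obtain ⟨p, hp⟩ := hint
  have hPint : P ∈ interior K := by
    refine mem_interior.2 ⟨(fun z => p + t⁻¹ • (z - P)) ⁻¹' interior K, fun z hz => ?_,
      isOpen_interior.preimage (by fun_prop), by simpa using hp⟩
    have := hPt _ (Set.sub_mem_sub (interior_subset hz) (interior_subset hp))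
    simpa [smul_smul, ht.ne'] using this
  have h1 : t ≤ asym K P := le_csSup ⟨_, hub P (interior_subset hPint)⟩ ⟨ht.le, hPt⟩
  refine h1.trans (le_csSup ⟨Metric.diam K / ‖x - y‖, ?_⟩ ⟨P, ⟨hP, hPint⟩, rfl⟩)
  rintro _ ⟨Q, ⟨-, hQ⟩, rfl⟩
  exact Real.sSup_le (hub Q (interior_subset hQ)) (by positivity)

/-- An interior point is a positive combination, of total weight less than one, of the vertices
of any given simplex and boundedly many further points of a set spanning the convex body. -/
lemma exists_pos_combination {d : ℕ} {V : Set (Fin d → ℝ)} {v : Fin (d + 1) → Fin d → ℝ}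
    {P : Fin d → ℝ} (hP : P ∈ interior (convexHull ℝ V)) :
    ∃ (ι : Type) (_ : Fintype ι) (z : ι → Fin d → ℝ) (b : Fin (d + 1) ⊕ ι → ℝ),
      Fintype.card ι ≤ d + 1 ∧ (∀ i, z i ∈ V) ∧ (∀ i, 0 < b i) ∧ ∑ i, b i < 1 ∧
        ∑ i, b i • Sum.elim v z i = P := by
  set s := ∑ i, v i with hs
  have hden : ContinuousAt (fun η : ℝ => (1 - (d + 2) * η)⁻¹ • (P - η • s)) 0 := by
    have h1 : ContinuousAt (fun η : ℝ => (1 - (d + 2) * η)⁻¹) 0 :=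
      ContinuousAt.inv₀ (by fun_prop) (by simp)
    exact h1.smul (by fun_prop)
  have hlim : Filter.Tendsto (fun η : ℝ => (1 - (d + 2) * η)⁻¹ • (P - η • s)) (nhds 0)
      (nhds P) := by
    simpa [ContinuousAt] using hden
  have hlt : ∀ᶠ η : ℝ in nhds 0, (d + 2) * η < 1 := by
    have : Filter.Tendsto (fun η : ℝ => (d + 2) * η) (nhds 0) (nhds ((d + 2) * 0)) :=
      Continuous.tendsto (by fun_prop) 0
    exact this.eventually (gt_mem_nhds (by simp))
  obtain ⟨η, ⟨hQ, hη1⟩, hη0⟩ := ((((hlim.eventually (mem_interior_iff_mem_nhds.1 hP)).and hlt).filter_mono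
    (nhdsWithin_le_nhds (s := Set.Ioi (0 : ℝ)))).and self_mem_nhdsWithin).exists
  obtain ⟨ι, hι, z, w, hzV, hz, hw, hw1, hwz⟩ := eq_pos_convex_span_of_mem_convexHull hQ
  have hη0 : 0 < η := hη0
  have hpos : 0 < 1 - (d + 2) * η := by linarith
  refine ⟨ι, hι, z, Sum.elim (fun _ => η) fun i => (1 - (d + 2) * η) * w i, ?_,
    fun i => hzV ⟨i, rfl⟩, ?_, ?_, ?_⟩
  · have h1 := hz.card_le_finrank_succ
    have h2 := Submodule.finrank_le (vectorSpan ℝ (Set.range z))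
    rw [Module.finrank_fintype_fun_eq_card, Fintype.card_fin] at h2
    omega
  · rintro (i | i)
    · exact hη0
    · exact mul_pos hpos (hw i)
  · simp only [Fintype.sum_sum_type, Sum.elim_inl, Sum.elim_inr, Finset.sum_const,
      Finset.card_univ, Fintype.card_fin, ← Finset.mul_sum, hw1, nsmul_eq_mul]
    push_cast
    linarith
  · simp only [Fintype.sum_sum_type, Sum.elim_inl, Sum.elim_inr, ← Finset.smul_sum, mul_smul,
      hwz]
    rw [smul_inv_smul₀ hpos.ne', ← hs]
    abel

/-- **generalized Pikhurko theorem.** Fix `d ≥ 1` and an ACC set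
`A ⊆ (0, ∞)`. There is `c > 0` such that every compact polytope `□ = conv F ⊆ ℝ^d` with
nonempty interior, `0 ∈ □`, all nonzero extremal points of the form `(1/a) • e` with
`e ∈ ℤ^d` primitive and `a ∈ A`, and with a lattice point interior to `□`, satisfies
`γ(ℤ^d, □) ≥ c`. -/
theorem stmt_7 (d : ℕ) (hd : 1 ≤ d) (A : Set ℝ) (hA : A ⊆ Set.Ioi 0) (hACC : ACCSet A) :
    ∃ c : ℝ, 0 < c ∧ ∀ (F : Finset (Fin d → ℝ)) (K : Set (Fin d → ℝ)),
      K = convexHull ℝ (F : Set (Fin d → ℝ)) →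
      (interior K).Nonempty →
      (0 : Fin d → ℝ) ∈ K →
      (∀ v ∈ Set.extremePoints ℝ K, v ≠ 0 →
        ∃ (e : Fin d → ℤ) (a : ℝ), Primitive e ∧ a ∈ A ∧ v = (1 / a) • fun i => (e i : ℝ)) →
      (intLat d ∩ interior K).Nonempty →
      c ≤ pik K := by
  obtain ⟨c, hc, hcx⟩ := exists_uniform_weighted_bound_of_card_le hA hACC (2 * (d + 1))
  refine ⟨c / 2, by positivity, ?_⟩
  rintro F K hKF hint h0 hext ⟨P, hPZ, hPint⟩
  have hKc : Convex ℝ K := hKF ▸ convex_convexHull ℝ _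
  have hKcpt : IsCompact K := hKF ▸ F.finite_toSet.isCompact_convexHull ℝ
  set V := Set.extremePoints ℝ K with hVdef
  have hVfin : V.Finite := by
    refine F.finite_toSet.subset ?_
    rw [hVdef, hKF]
    exact extremePoints_convexHull_subset
  have hVK : convexHull ℝ V = K := by
    rw [← (hVfin.isClosed_convexHull ℝ).closure_eq]
    exact closure_convexHull_extremePoints hKcpt hKc
  have hVne : ∃ v ∈ V, v ≠ 0 := by
    by_contra! h
    have : K ⊆ {0} := by
      rw [← hVK]
      exact convexHull_min (fun v hv => h v hv) (convex_singleton 0)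
    exact Set.not_nontrivial_singleton ((nontrivial_of_nonempty_interior hd hint).mono this)
  have hform : ∀ v ∈ V, ∃ (e : Fin d → ℤ) (a : ℝ), a ∈ A ∧ v = (1 / a) • fun i => (e i : ℝ) := by
    intro v hv
    by_cases hv0 : v = 0
    · obtain ⟨u, huV, hu⟩ := hVne
      obtain ⟨-, a, -, ha, -⟩ := hext u huV hu
      exact ⟨0, a, ha, by subst hv0; ext; simp⟩
    · obtain ⟨e, a, -, ha, h⟩ := hext v hv hv0
      exact ⟨e, a, ha, h⟩
  obtain ⟨v, hvV, hv⟩ := exists_simplex_abs_barycentric_le_one hVfin (hVK.symm ▸ hint)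
  obtain ⟨ι, _, z, b, hcard, hzV, hb, hb1, hbP⟩ :=
    exists_pos_combination (v := v) (hVK.symm ▸ hPint)
  set g : Fin (d + 1) ⊕ ι → Fin d → ℝ := Sum.elim v z with hg
  have hgV : ∀ i, g i ∈ V := by
    rintro (i | i)
    · exact hvV i
    · exact hzV i
  choose e a haA hga using fun i => hform (g i) (hgV i)
  have hapos : ∀ i, 0 < a i := fun i => hA (haA i)
  obtain ⟨m, n, hmn, hmn1⟩ := hcx (Fin (d + 1) ⊕ ι)
    (by rw [Fintype.card_sum, Fintype.card_fin]; omega) a (fun i => b i / a i) haA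
    (fun i => div_pos (hb i) (hapos i)) (by
      simpa [mul_div_cancel₀, (hapos _).ne'] using hb1)
  set β : Fin (d + 1) ⊕ ι → ℝ := fun i => a i * (m * (b i / a i) - n i) with hβ
  have hsum : ∑ i, β i • g i = fun k => m * P k - ∑ i, (n i : ℝ) * e i k := by
    ext k
    rw [← hbP, Finset.sum_apply, Finset.sum_apply, Finset.mul_sum, ← Finset.sum_sub_distrib]
    refine Finset.sum_congr rfl fun i _ => ?_
    have hi := (hapos i).ne'
    rw [Pi.smul_apply, Pi.smul_apply, hga i]
    simp only [hβ, Pi.smul_apply, smul_eq_mul]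
    field_simp
  refine le_pik hd hKcpt.isBounded hint (P := ∑ i, β i • g i) ?_ (by positivity) ?_
  · intro k
    obtain ⟨p, hp⟩ := hPZ k
    refine ⟨m * p - ∑ i, n i * e i k, ?_⟩
    rw [hsum]
    push_cast
    rw [hp]
  · rintro _ ⟨x, hx, y, hy, rfl⟩
    obtain ⟨l, hl, hl1, rfl⟩ := hv x (hVK.symm ▸ hx)
    obtain ⟨l', hl', hl1', rfl⟩ := hv y (hVK.symm ▸ hy)
    set μ : Fin (d + 1) ⊕ ι → ℝ := Sum.elim (fun i => c / 2 * (l i - l' i)) 0 with hμ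
    have hμg : ∑ i, μ i • g i =
        (c / 2) • ((fun x1 x2 => x1 - x2) (∑ i, l i • v i) (∑ i, l' i • v i)) := by
      simp only [hμ, hg, Fintype.sum_sum_type, Sum.elim_inl, Sum.elim_inr, Pi.zero_apply,
        zero_smul, Finset.sum_const_zero, add_zero, mul_smul, sub_smul, Finset.sum_sub_distrib,
        ← Finset.smul_sum]
    have hμ0 : ∑ i, μ i = 0 := by
      simp [hμ, Fintype.sum_sum_type, ← Finset.mul_sum, hl1, hl1']
    rw [← hμg, ← Finset.sum_add_distrib]
    simp_rw [← add_smul]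
    refine hKc.sum_smul_mem_of_sum_le_one h0 (fun i => ?_) ?_ fun i => (hgV i).1
    · have hi : c ≤ β i := hmn i
      rcases i with i | i
      · have h1 := (abs_le.1 (hl i)).1
        have h2 := (abs_le.1 (hl' i)).2
        simp only [hμ, Sum.elim_inl]
        nlinarith
      · simp only [hμ, Sum.elim_inr, Pi.zero_apply]
        linarith
    · rw [Finset.sum_add_distrib, hμ0, add_zero]
      exact hmn1
end

section
/- Let d ≥ 2 and let □ ⊆ ℝ^d be a compact convex set with nonempty interior. Let τ > 0 and let b ∈ ℤ^d be primitive with b ∈ τ • (□ − □). Let π : ℝ^d → ℝ^{d−1} be a surjective linear map with ker π = ℝ • b and π(ℤ^d) = ℤ^{d−1}, and set □' = π(□). Suppose ℤ^{d−1} ∩ interior □' ≠ ∅ and let γ' = γ(ℤ^{d−1}, □') be the Pikhurko constant of □'. If τ < γ', then ℤ^d ∩ interior □ ≠ ∅ and γ(ℤ^d, □) ≥ (γ' − τ)/2. -/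
open Pointwise

/-- A homothety of ratio `0 ≤ t < 1` mapping a nonempty compact set to itself has a fixed point
in it. -/
lemma IsCompact.exists_fixed_homothety {E : Type*} [NormedAddCommGroup E] [NormedSpace ℝ E]
    {K : Set E} (hK : IsCompact K) (hne : K.Nonempty) {t : ℝ} (ht₀ : 0 ≤ t) (ht₁ : t < 1) {v : E}
    (h : ∀ z ∈ K, v + t • z ∈ K) : ∃ z ∈ K, v + t • z = z := by
  obtain ⟨x, hx⟩ := hne
  have hmaps : Set.MapsTo (fun z => v + t • z) K K := h
  have hcontr : ContractingWith ⟨t, ht₀⟩ (hmaps.restrict _ K K) := by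
    refine ⟨ht₁, LipschitzWith.of_dist_le_mul fun y z => ?_⟩
    change dist (v + t • (y : E)) (v + t • (z : E)) ≤ t * dist (y : E) (z : E)
    rw [dist_add_left, dist_smul₀, Real.norm_of_nonneg ht₀]
  obtain ⟨z, hz, hfix, -⟩ := hcontr.exists_fixedPoint' hK.isComplete hmaps hx (edist_ne_top _ _)
  exact ⟨z, hz, hfix⟩

/-- If `t` is admissible for the coefficient of asymmetry of the point `π p` in the projection
`π '' K` along a line, then `t / 2` is admissible for some point of `K` in the fibre of `π p`. -/
lemma exists_lift_of_admissible {E F : Type*} [NormedAddCommGroup E] [NormedSpace ℝ E]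
    [NormedAddCommGroup F] [NormedSpace ℝ F] {K : Set E} (hc : IsCompact K) (hconv : Convex ℝ K)
    (π : E →L[ℝ] F) {b : E} (hb : b ≠ 0)
    (hker : LinearMap.ker (π : E →ₗ[ℝ] F) = Submodule.span ℝ {b}) (p : E) {t : ℝ}
    (ht₀ : 0 ≤ t) (ht₁ : t < 1) (h : ∀ x ∈ K, ∀ y ∈ K, π p + t • (π x - π y) ∈ π '' K) :
    ∃ q, π q = π p ∧ ∀ x ∈ K - K, q + (t / 2) • x ∈ K := by
  have hfib : ∀ q, π q = π p → ∃ s : ℝ, p + s • b = q := fun q hq => by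
    have : q - p ∈ LinearMap.ker (π : E →ₗ[ℝ] F) := by simp [hq]
    rw [hker, Submodule.mem_span_singleton] at this
    obtain ⟨s, hs⟩ := this
    exact ⟨s, by rw [hs]; abel⟩
  have hπb : π b = 0 := by
    have : b ∈ LinearMap.ker (π : E →ₗ[ℝ] F) := hker ▸ Submodule.mem_span_singleton_self b
    simpa using this
  have hcancel : ∀ w ∈ K, ∃ z ∈ K, (1 - t) • π z = π p - t • π w := fun w hw => by
    obtain ⟨z', ⟨z, hz, rfl⟩, hzfix⟩ := (hc.image π.continuous).exists_fixed_homothety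
      ⟨π w, w, hw, rfl⟩ ht₀ ht₁ (v := π p - t • π w) (by
        rintro _ ⟨z, hz, rfl⟩
        convert h z hz w hw using 1
        module)
    refine ⟨z, hz, ?_⟩
    rw [sub_smul, one_smul]
    exact sub_eq_of_eq_add hzfix.symm
  have hpair : ∀ x₁ ∈ K, ∀ x₂ ∈ K, ∀ y₁ ∈ K, ∀ y₂ ∈ K, ∃ s : ℝ,
      p + s • b + (t / 2) • (x₁ - x₂) ∈ K ∧ p + s • b + (t / 2) • (y₁ - y₂) ∈ K := by
    intro x₁ hx₁ x₂ hx₂ y₁ hy₁ y₂ hy₂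
    obtain ⟨z, hz, hzw⟩ := hcancel (midpoint ℝ x₂ y₂) (hconv.midpoint_mem hx₂ hy₂)
    have hcomb : ∀ u ∈ K, ∀ v ∈ K, (1 - t) • z + t • midpoint ℝ u v ∈ K := fun u hu v hv =>
      hconv hz (hconv.midpoint_mem hu hv) (by linarith) ht₀ (by ring)
    obtain ⟨s, hs⟩ := hfib ((1 - t) • z + t • midpoint ℝ x₂ y₂) (by
      rw [map_add, map_smul, map_smul, hzw]; abel)
    refine ⟨s, ?_, ?_⟩
    · convert hcomb x₁ hx₁ y₂ hy₂ using 1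
      rw [hs, midpoint_eq_smul_add, midpoint_eq_smul_add, invOf_eq_inv]
      module
    · convert hcomb x₂ hx₂ y₁ hy₁ using 1
      rw [hs, midpoint_eq_smul_add, midpoint_eq_smul_add, invOf_eq_inv]
      module
  classical
  let f (i : K × K) : ℝ → E := fun s => p + s • b + (t / 2) • ((i.1 : E) - i.2)
  have hf : ∀ i s, f i s = (s • b) + (p + (t / 2) • ((i.1 : E) - i.2)) := fun i s => by
    simp only [f]; abel
  have hne : (⋂ i, f i ⁻¹' K).Nonempty := by
    refine Convex.helly_theorem_compact' (𝕜 := ℝ) (fun i => ?_) (fun i => ?_) (fun I hI => ?_)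
    · intro s hs s' hs' α β hα hβ hαβ
      have := hconv hs hs' hα hβ hαβ
      rw [hf, hf] at this
      rw [Set.mem_preimage, hf]
      convert this using 1
      rw [← eq_sub_iff_add_eq'] at hαβ
      subst hαβ
      simp only [smul_eq_mul]
      module
    · have hemb := (Homeomorph.addRight (p + (t / 2) • ((i.1 : E) - i.2))).isClosedEmbedding.comp
        (isClosedEmbedding_smul_left (𝕜 := ℝ) hb)
      convert! hemb.isCompact_preimage hc using 2
      exact funext (hf i)
    · rw [Module.finrank_self] at hI
      obtain hI | hI | hI : I.card = 0 ∨ I.card = 1 ∨ I.card = 2 := by omega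
      · rw [Finset.card_eq_zero] at hI
        simp [hI]
      · obtain ⟨i, rfl⟩ := Finset.card_eq_one.1 hI
        obtain ⟨s, hs, -⟩ := hpair i.1 i.1.2 i.2 i.2.2 i.1 i.1.2 i.2 i.2.2
        exact ⟨s, by simpa using hs⟩
      · obtain ⟨i, j, -, rfl⟩ := Finset.card_eq_two.1 hI
        obtain ⟨s, hs, hs'⟩ := hpair i.1 i.1.2 i.2 i.2.2 j.1 j.1.2 j.2 j.2.2
        exact ⟨s, by simpa using ⟨hs, hs'⟩⟩
  obtain ⟨s, hs⟩ := hne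
  refine ⟨p + s • b, by simp [hπb], ?_⟩
  rintro _ ⟨x, hx, y, hy, rfl⟩
  exact Set.mem_iInter.1 hs (⟨x, hx⟩, ⟨y, hy⟩)

/-- Admissible parameters for the coefficient of asymmetry of a bounded set with at least two
points are at most `1 / 2`. -/
lemma admissible_le_half {E : Type*} [NormedAddCommGroup E] [NormedSpace ℝ E] {K : Set E}
    (hK : Bornology.IsBounded K) (hnt : K.Nontrivial) {P : E} {t : ℝ} (ht₀ : 0 ≤ t)
    (h : ∀ x ∈ K - K, P + t • x ∈ K) : t ≤ 1 / 2 := by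
  obtain ⟨x, hx, y, hy, hxy⟩ := hnt
  have hpos : 0 < Metric.diam K :=
    (dist_pos.2 hxy).trans_le (Metric.dist_le_diam_of_mem hK hx hy)
  have hle : ∀ x ∈ K, ∀ y ∈ K, 2 * t * dist x y ≤ Metric.diam K := fun x hx y hy => by
    have := Metric.dist_le_diam_of_mem hK (h _ (Set.sub_mem_sub hx hy))
      (h _ (Set.sub_mem_sub hy hx))
    have heq : P + t • (x - y) - (P + t • (y - x)) = (2 * t) • (x - y) := by module
    rwa [dist_eq_norm, heq, norm_smul, ← dist_eq_norm,
      Real.norm_of_nonneg (by positivity)] at this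
  by_contra! hlt
  have hdiam : Metric.diam K ≤ Metric.diam K / (2 * t) :=
    Metric.diam_le_of_forall_dist_le (by positivity) fun x hx y hy => by
      rw [le_div_iff₀ (by linarith), mul_comm]
      exact hle x hx y hy
  rw [le_div_iff₀ (by linarith)] at hdiam
  nlinarith

/-- A point with a positive admissible parameter lies in the interior. -/
lemma mem_interior_of_admissible {E : Type*} [NormedAddCommGroup E] [NormedSpace ℝ E] {K : Set E}
    (hne : (interior K).Nonempty) {P : E} {t : ℝ} (ht : 0 < t)
    (h : ∀ x ∈ K - K, P + t • x ∈ K) : P ∈ interior K := by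
  obtain ⟨k, hk⟩ := hne
  refine mem_interior.2 ⟨(fun y => k + t⁻¹ • (y - P)) ⁻¹' interior K, fun y hy => ?_,
    isOpen_interior.preimage (by fun_prop), by simpa using hk⟩
  have := h _ (Set.sub_mem_sub (interior_subset hy) (interior_subset hk))
  simpa [smul_smul, ht.ne'] using this

lemma Set.Nontrivial.of_interior_nonempty {E : Type*} [NormedAddCommGroup E] [NormedSpace ℝ E]
    [Nontrivial E] {K : Set E} (hne : (interior K).Nonempty) : K.Nontrivial := by
  obtain ⟨x, hx⟩ := hne
  have := Module.punctured_nhds_neBot ℝ E x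
  exact (infinite_of_mem_nhds x (mem_interior_iff_mem_nhds.1 hx)).nontrivial

/-- An admissible parameter at an interior lattice point bounds the Pikhurko constant from
below. -/
lemma le_pik_of_admissible {d : ℕ} {K : Set (Fin d → ℝ)} (hK : Bornology.IsBounded K)
    (hnt : K.Nontrivial) {P : Fin d → ℝ} (hP : P ∈ intLat d ∩ interior K) {t : ℝ} (ht₀ : 0 ≤ t)
    (h : ∀ x ∈ K - K, P + t • x ∈ K) : t ≤ pik K := by
  have hasym : t ≤ asym K P :=
    le_csSup ⟨1 / 2, fun s hs => admissible_le_half hK hnt hs.1 hs.2⟩ ⟨ht₀, h⟩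
  refine hasym.trans (le_csSup ⟨1 / 2, ?_⟩ ⟨P, hP, rfl⟩)
  rintro _ ⟨Q, -, rfl⟩
  exact Real.sSup_le (fun s hs => admissible_le_half hK hnt hs.1 hs.2) (by norm_num)

/-- Any value below the Pikhurko constant is exceeded by an admissible parameter at an interior
lattice point. -/
lemma exists_admissible_of_lt_pik {d : ℕ} {K : Set (Fin d → ℝ)} {c : ℝ} (hc₀ : 0 ≤ c)
    (hc : c < pik K) : ∃ P ∈ intLat d ∩ interior K, ∃ t, c < t ∧ ∀ x ∈ K - K, P + t • x ∈ K := by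
  have hne : ∀ {S : Set ℝ}, c < sSup S → S.Nonempty := fun hS => by
    by_contra hS'
    rw [Set.not_nonempty_iff_eq_empty.1 hS', Real.sSup_empty] at hS
    linarith
  obtain ⟨_, ⟨P, hP, rfl⟩, hcP⟩ := exists_lt_of_lt_csSup (hne hc) hc
  obtain ⟨t, ht, hct⟩ := exists_lt_of_lt_csSup (hne hcP) hcP
  exact ⟨P, hP, t, hct, ht.2⟩

/-- Shifting an admissible point along a difference vector of `K` scaled by at most `τ / 2`
decreases the admissible parameter by at most `τ / 2`. -/
lemma admissible_shift {E : Type*} [AddCommGroup E] [Module ℝ E] {K : Set E}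
    (hconv : Convex ℝ K) {q e : E} {t τ : ℝ} (hτ : 0 < τ) (hτt : τ < t)
    (hq : ∀ x ∈ K - K, q + (t / 2) • x ∈ K) (he : e ∈ K - K) {μ : ℝ} (hμ : |μ| ≤ 1 / 2) :
    ∀ x ∈ K - K, q + (μ * τ) • e + ((t - τ) / 2) • x ∈ K := by
  intro x hx
  have ht : 0 < t := hτ.trans hτt
  obtain ⟨hμ₁, hμ₂⟩ := abs_le.1 hμ
  have hD : Convex ℝ (K - K) := hconv.sub hconv
  have he' : -e ∈ K - K := by
    obtain ⟨y, hy, z, hz, rfl⟩ := he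
    exact ⟨z, hz, y, hy, (neg_sub y z).symm⟩
  have hμe : (2 * μ) • e ∈ K - K := by
    convert hD he he' (a := 1 / 2 + μ) (b := 1 / 2 - μ) (by linarith) (by linarith) (by ring)
      using 1
    module
  have hw := hD hμe hx (a := τ / t) (b := (t - τ) / t) (by positivity)
    (div_nonneg (by linarith) ht.le) (by field_simp; ring)
  convert hq _ hw using 1
  rw [smul_add, smul_smul, smul_smul, smul_smul, add_assoc]
  congr 3 <;> field_simp

/-- Let `d ≥ 2`, `□ ⊆ ℝ^d` compact convex with nonempty interior, `τ > 0`,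
`b ∈ ℤ^d` primitive with `b ∈ τ • (□ - □)`, and `π : ℝ^d → ℝ^{d-1}` surjective linear with
`ker π = ℝ • b` and `π(ℤ^d) = ℤ^{d-1}`; set `□' = π(□)`. If `ℤ^{d-1} ∩ int □' ≠ ∅` and
`τ < γ' = γ(ℤ^{d-1}, □')`, then `ℤ^d ∩ int □ ≠ ∅` and `γ(ℤ^d, □) ≥ (γ' - τ)/2`. -/
theorem stmt_9 (d : ℕ) (hd : 2 ≤ d) (K : Set (Fin d → ℝ))
    (hc : IsCompact K) (hconv : Convex ℝ K) (hne : (interior K).Nonempty)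
    (τ : ℝ) (hτ : 0 < τ) (b : Fin d → ℤ) (hb : Primitive b)
    (hbτ : (fun i => (b i : ℝ)) ∈ τ • (K - K))
    (π : (Fin d → ℝ) →ₗ[ℝ] (Fin (d - 1) → ℝ)) (hπs : Function.Surjective π)
    (hker : LinearMap.ker π = Submodule.span ℝ {fun i => (b i : ℝ)})
    (hlat : π '' intLat d = intLat (d - 1))
    (hne' : (intLat (d - 1) ∩ interior (π '' K)).Nonempty)
    (hτγ : τ < pik (π '' K)) :
    (intLat d ∩ interior K).Nonempty ∧ (pik (π '' K) - τ) / 2 ≤ pik K := by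
  have hbR : (fun i => (b i : ℝ)) ≠ 0 := fun h =>
    hb.1 (funext fun i => Int.cast_eq_zero.1 (congrFun h i))
  have : NeZero d := ⟨by omega⟩
  have : NeZero (d - 1) := ⟨by omega⟩
  have hK := Set.Nontrivial.of_interior_nonempty hne
  have hK' := Set.Nontrivial.of_interior_nonempty (hne'.mono Set.inter_subset_right)
  have hcont : Continuous π := π.continuous_of_finiteDimensional
  have key : ∀ c, τ ≤ c → c < pik (π '' K) → ∃ P ∈ intLat d ∩ interior K, (c - τ) / 2 ≤ pik K := by
    intro c hτc hc'
    obtain ⟨P', hP', t, hct, ht⟩ := exists_admissible_of_lt_pik (hτ.le.trans hτc) hc'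
    have hτt : τ < t := hτc.trans_lt hct
    have ht₀ : 0 < t := hτ.trans hτt
    have ht₁ := admissible_le_half (hc.image hcont).isBounded hK' ht₀.le ht
    obtain ⟨p, hp, rfl⟩ : P' ∈ π '' intLat d := hlat ▸ hP'.1
    obtain ⟨q, hq, hqK⟩ := exists_lift_of_admissible hc hconv ⟨π, hcont⟩ hbR hker p ht₀.le
      (by linarith) fun x hx y hy => ht _ (Set.sub_mem_sub ⟨x, hx, rfl⟩ ⟨y, hy, rfl⟩)
    obtain ⟨s, hs⟩ : ∃ s : ℝ, s • (fun i => (b i : ℝ)) = q - p := by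
      rw [← Submodule.mem_span_singleton, ← hker, LinearMap.mem_ker, map_sub]
      exact sub_eq_zero.2 hq
    obtain ⟨e, he, heb⟩ := hbτ
    simp only at heb
    set P : Fin d → ℝ := q + ((round s - s) * τ) • e with hPdef
    have hPK : ∀ x ∈ K - K, P + ((t - τ) / 2) • x ∈ K :=
      admissible_shift hconv hτ hτt hqK he (by rw [abs_sub_comm]; exact abs_sub_round s)
    have hPp : P = p + (round s : ℝ) • (fun i => (b i : ℝ)) := by
      rw [hPdef, mul_smul, heb, sub_smul, hs]
      abel
    have hPlat : P ∈ intLat d := fun i => by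
      obtain ⟨z, hz⟩ := hp i
      exact ⟨z + round s * b i, by simp [hPp, hz]⟩
    have hPint := mem_interior_of_admissible hne (by linarith) hPK
    refine ⟨P, ⟨hPlat, hPint⟩, ?_⟩
    linarith [le_pik_of_admissible hc.isBounded hK ⟨hPlat, hPint⟩ (by linarith) hPK]
  refine ⟨?_, ?_⟩
  · obtain ⟨P, hP, -⟩ := key τ le_rfl hτγ
    exact ⟨P, hP⟩
  · by_contra! hlt
    obtain ⟨c, hc₁, hc₂⟩ := exists_between (max_lt hτγ (by linarith : 2 * pik K + τ < pik (π '' K)))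
    obtain ⟨-, -, hle⟩ := key c ((le_max_left _ _).trans hc₁.le) hc₂
    linarith [(le_max_right τ (2 * pik K + τ)).trans_lt hc₁]
end
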